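/- Let Γ, Δ be finite multisets of 2PC formulas and Γ₁, Δ₁ finite multisets of PC formulas. Then Γ ⊢_1 Δ is provable in the 2PC sequent calculus if and only if Γ• ⊢ Δ• is provable in the classical PC sequent calculus, and Γ₁ ⊢ Δ₁ is provable in the PC sequent calculus if and only if Γ₁° ⊢_1 Δ₁° is provable in the 2PC sequent calculus. -/

import Mathlib

/-- Formulas of the n-dimensional propositional calculus nPC:
decorated variables `X^π`, constants `e_k`, and compounds `q(F,G_1,…,G_n)`.
Dimensions are elements of `Fin n`; propositional variables are natural numbers. -/
inductive Fm (n : ℕ) : Type where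
  | var (X : ℕ) (π : Equiv.Perm (Fin n)) : Fm n
  | const (k : Fin n) : Fm n
  | q (F : Fm n) (G : Fin n → Fm n) : Fm n

/-- The action `F^ρ` of a permutation `ρ` on a formula. -/
def Fm.act {n : ℕ} (ρ : Equiv.Perm (Fin n)) : Fm n → Fm n
  | .var X π => .var X (ρ * π)
  | .const k => .const (ρ k)
  | .q F G => .q F (fun j => (G j).act ρ)

/-- The action of a permutation on a multiset of formulas (context). -/
def actM {n : ℕ} (ρ : Equiv.Perm (Fin n)) (Γ : Multiset (Fm n)) : Multiset (Fm n) :=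
  Γ.map (Fm.act ρ)

/-- The sequent calculus of nPC: `Proves Γ i Δ` means the sequent `Γ ⊢_i Δ` is provable. -/
inductive Proves {n : ℕ} : Multiset (Fm n) → Fin n → Multiset (Fm n) → Prop where
  | const (i : Fin n) : Proves 0 i {Fm.const i}
  | id (X : ℕ) (π ρ : Equiv.Perm (Fin n)) (i : Fin n) (h : π⁻¹ i = ρ⁻¹ i) :
      Proves {Fm.var X π} i {Fm.var X ρ}
  | sym (Γ Δ : Multiset (Fm n)) (i j : Fin n)
      (h : Proves (actM (Equiv.swap i j) Γ) i (actM (Equiv.swap i j) Δ)) :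
      Proves Γ j Δ
  | neg1 (Γ Δ : Multiset (Fm n)) (F : Fm n) (i j k : Fin n) (hik : i ≠ k)
      (h : Proves (actM (Equiv.swap i j) Γ) i (F ::ₘ actM (Equiv.swap i j) Δ)) :
      Proves (F.act (Equiv.swap j k) ::ₘ Γ) j Δ
  | neg2 (Γ Δ : Multiset (Fm n)) (F : Fm n) (i j k : Fin n) (hjk : j ≠ k)
      (h : Proves (actM (Equiv.swap i j) Γ) i (F ::ₘ actM (Equiv.swap i j) Δ)) :
      Proves (F.act (Equiv.swap i k) ::ₘ Γ) j Δ
  | neg3 (Γ Δ : Multiset (Fm n)) (F : Fm n) (j : Fin n)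
      (h : ∀ i : Fin n, i ≠ j →
        Proves (F ::ₘ actM (Equiv.swap i j) Γ) i (actM (Equiv.swap i j) Δ)) :
      Proves Γ j (F ::ₘ Δ)
  | qL (Γ Δ : Multiset (Fm n)) (F : Fm n) (G : Fin n → Fm n) (i : Fin n)
      (h : ∀ j : Fin n,
        Proves ((G j).act (Equiv.swap j i) ::ₘ F ::ₘ actM (Equiv.swap j i) Γ) j
          (actM (Equiv.swap j i) Δ)) :
      Proves (Fm.q F G ::ₘ Γ) i Δ
  | qR (Γ Δ : Multiset (Fm n)) (F : Fm n) (G : Fin n → Fm n) (i : Fin n)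
      (h : ∀ j : Fin n,
        Proves (F ::ₘ actM (Equiv.swap j i) Γ) j
          ((G j).act (Equiv.swap j i) ::ₘ actM (Equiv.swap j i) Δ)) :
      Proves Γ i (Fm.q F G ::ₘ Δ)
  | cut (Γ Δ : Multiset (Fm n)) (F : Fm n) (i : Fin n)
      (h1 : Proves (F ::ₘ Γ) i Δ) (h2 : Proves Γ i (F ::ₘ Δ)) : Proves Γ i Δ
  | weakL (Γ Δ : Multiset (Fm n)) (F : Fm n) (i : Fin n)
      (h : Proves Γ i Δ) : Proves (F ::ₘ Γ) i Δ
  | weakR (Γ Δ : Multiset (Fm n)) (F : Fm n) (i : Fin n)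
      (h : Proves Γ i Δ) : Proves Γ i (F ::ₘ Δ)
  | conL (Γ Δ : Multiset (Fm n)) (F : Fm n) (i : Fin n)
      (h : Proves (F ::ₘ F ::ₘ Γ) i Δ) : Proves (F ::ₘ Γ) i Δ
  | conR (Γ Δ : Multiset (Fm n)) (F : Fm n) (i : Fin n)
      (h : Proves Γ i (F ::ₘ F ::ₘ Δ)) : Proves Γ i (F ::ₘ Δ)

/-- The semantics `⟦F⟧v` of a formula in an environment `v`. -/
def Fm.sem {n : ℕ} (v : ℕ → Fin n) : Fm n → Fin n
  | .var X π => π (v X)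
  | .const k => k
  | .q F G => (G (F.sem v)).sem v

/-- `Γ ⊨_i Δ`: every environment making all of `Γ` equal `i` makes some formula of `Δ` equal `i`. -/
def Models {n : ℕ} (Γ : Multiset (Fm n)) (i : Fin n) (Δ : Multiset (Fm n)) : Prop :=
  ∀ v : ℕ → Fin n, (∀ G ∈ Γ, Fm.sem v G = i) → ∃ F ∈ Δ, Fm.sem v F = i

/-- Logical equivalence `F ∼ G`: both `F ⊢_i G` and `G ⊢_i F` are provable for every `i`. -/
def Eqv {n : ℕ} (F G : Fm n) : Prop :=
  ∀ i : Fin n, Proves {F} i {G} ∧ Proves {G} i {F}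

/-- Provability from a (possibly infinite) set of hypotheses:
some finite sub-multiset of `Γ` proves `Δ` at `i`. -/
def ProvesSet {n : ℕ} (Γ : Set (Fm n)) (i : Fin n) (Δ : Multiset (Fm n)) : Prop :=
  ∃ Γ' : Multiset (Fm n), (∀ G ∈ Γ', G ∈ Γ) ∧ Proves Γ' i Δ

/-- `Γ ⊨_i F` for a set `Γ` of hypotheses. -/
def ModelsSet {n : ℕ} (Γ : Set (Fm n)) (i : Fin n) (F : Fm n) : Prop :=
  ∀ v : ℕ → Fin n, (∀ G ∈ Γ, Fm.sem v G = i) → Fm.sem v F = i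

/-- Formulas of classical propositional calculus PC. -/
inductive PFm : Type where
  | tru : PFm
  | fls : PFm
  | var (X : ℕ) : PFm
  | neg (P : PFm) : PFm
  | and (P Q : PFm) : PFm
  | or (P Q : PFm) : PFm

/-- PC semantics with values in `Fin 2`: `0` plays the role of true (`1` in the paper)
and `1` plays the role of false (`0` in the paper). -/
def PFm.sem (v : ℕ → Fin 2) : PFm → Fin 2
  | .tru => 0
  | .fls => 1
  | .var X => v X
  | .neg P => if P.sem v = 0 then 1 else 0
  | .and P Q => if P.sem v = 0 ∧ Q.sem v = 0 then 0 else 1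
  | .or P Q => if P.sem v = 0 ∨ Q.sem v = 0 then 0 else 1

/-- The translation `(·)•` from 2PC formulas to PC formulas. -/
def toPC : Fm 2 → PFm
  | .var X π => if π 0 = 0 then .var X else .neg (.var X)
  | .const k => if k = 0 then .tru else .fls
  | .q F G => .or (.and (toPC F) (toPC (G 0))) (.and (.neg (toPC F)) (toPC (G 1)))

/-- The translation `(·)°` from PC formulas to 2PC formulas. -/
def toFm : PFm → Fm 2
  | .tru => .const 0
  | .fls => .const 1
  | .var X => .var X 1
  | .neg P => (toFm P).act (Equiv.swap 0 1)
  | .and P Q => .q (toFm P) ![toFm Q, .const 1]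
  | .or P Q => .q (toFm P) ![.const 0, toFm Q]

/-- The classical sequent calculus for PC. -/
inductive PProves : Multiset PFm → Multiset PFm → Prop where
  | tru : PProves 0 {PFm.tru}
  | fls : PProves {PFm.fls} 0
  | id (P : PFm) : PProves {P} {P}
  | andL (Γ Δ : Multiset PFm) (P Q : PFm)
      (h : PProves (P ::ₘ Q ::ₘ Γ) Δ) : PProves (PFm.and P Q ::ₘ Γ) Δ
  | andR (Γ Δ : Multiset PFm) (P Q : PFm)
      (h1 : PProves Γ (P ::ₘ Δ)) (h2 : PProves Γ (Q ::ₘ Δ)) :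
      PProves Γ (PFm.and P Q ::ₘ Δ)
  | orL (Γ Δ : Multiset PFm) (P Q : PFm)
      (h1 : PProves (P ::ₘ Γ) Δ) (h2 : PProves (Q ::ₘ Γ) Δ) :
      PProves (PFm.or P Q ::ₘ Γ) Δ
  | orR (Γ Δ : Multiset PFm) (P Q : PFm)
      (h : PProves Γ (P ::ₘ Q ::ₘ Δ)) : PProves Γ (PFm.or P Q ::ₘ Δ)
  | negL (Γ Δ : Multiset PFm) (P : PFm)
      (h : PProves Γ (P ::ₘ Δ)) : PProves (PFm.neg P ::ₘ Γ) Δ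
  | negR (Γ Δ : Multiset PFm) (P : PFm)
      (h : PProves (P ::ₘ Γ) Δ) : PProves Γ (PFm.neg P ::ₘ Δ)
  | cut (Γ Δ : Multiset PFm) (P : PFm)
      (h1 : PProves (P ::ₘ Γ) Δ) (h2 : PProves Γ (P ::ₘ Δ)) : PProves Γ Δ
  | weakL (Γ Δ : Multiset PFm) (P : PFm) (h : PProves Γ Δ) : PProves (P ::ₘ Γ) Δ
  | weakR (Γ Δ : Multiset PFm) (P : PFm) (h : PProves Γ Δ) : PProves Γ (P ::ₘ Δ)
  | conL (Γ Δ : Multiset PFm) (P : PFm)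
      (h : PProves (P ::ₘ P ::ₘ Γ) Δ) : PProves (P ::ₘ Γ) Δ
  | conR (Γ Δ : Multiset PFm) (P : PFm)
      (h : PProves Γ (P ::ₘ P ::ₘ Δ)) : PProves Γ (P ::ₘ Δ)

/-- `Γ ⊨ Δ` for PC. -/
def PModels (Γ Δ : Multiset PFm) : Prop :=
  ∀ v : ℕ → Fin 2, (∀ P ∈ Γ, PFm.sem v P = 0) → ∃ Q ∈ Δ, PFm.sem v Q = 0

section Kalmar

variable {A : Type*}

/-- The literals describing the values of `v` on the variables below `N`. -/
def literals (lit : ℕ → Fin 2 → A) (v : ℕ → Fin 2) : ℕ → Multiset A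
  | 0 => 0
  | N + 1 => lit N (v N) ::ₘ literals lit v N

theorem literals_congr (lit : ℕ → Fin 2 → A) {v w : ℕ → Fin 2} :
    ∀ {N : ℕ}, (∀ X < N, v X = w X) → literals lit v N = literals lit w N
  | 0, _ => rfl
  | N + 1, h => by
    rw [literals, literals, h N N.lt_succ_self,
      literals_congr lit fun X hX => h X (hX.trans N.lt_succ_self)]

theorem mem_literals (lit : ℕ → Fin 2 → A) (v : ℕ → Fin 2) {X : ℕ} :
    ∀ {N : ℕ}, X < N → lit X (v X) ∈ literals lit v N
  | N + 1, h => by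
    rw [literals, Multiset.mem_cons]
    rcases Nat.lt_succ_iff_lt_or_eq.mp h with h | rfl
    · exact Or.inr (mem_literals lit v h)
    · exact Or.inl rfl

variable {R : Multiset A → Multiset A → Prop}

theorem weaken_of_le (weakL : ∀ Γ Δ P, R Γ Δ → R (P ::ₘ Γ) Δ)
    (weakR : ∀ Γ Δ P, R Γ Δ → R Γ (P ::ₘ Δ)) {Γ Γ' Δ Δ' : Multiset A}
    (h : R Γ Δ) (hΓ : Γ ≤ Γ') (hΔ : Δ ≤ Δ') : R Γ' Δ' := by
  obtain ⟨Γ₀, rfl⟩ := Multiset.le_iff_exists_add.mp hΓ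
  obtain ⟨Δ₀, rfl⟩ := Multiset.le_iff_exists_add.mp hΔ
  have hL : R (Γ + Γ₀) Δ := by
    clear hΓ
    induction Γ₀ using Multiset.induction with
    | empty => simpa using h
    | cons P Γ₀ ih => rw [Multiset.add_cons]; exact weakL _ _ _ ih
  clear hΔ
  induction Δ₀ using Multiset.induction with
  | empty => simpa using hL
  | cons P Δ₀ ih => rw [Multiset.add_cons]; exact weakR _ _ _ ih

/-- Literals of variables can be eliminated one variable at a time by cut. -/
theorem eliminate_literals (weakL : ∀ Γ Δ P, R Γ Δ → R (P ::ₘ Γ) Δ)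
    (weakR : ∀ Γ Δ P, R Γ Δ → R Γ (P ::ₘ Δ))
    (cut : ∀ Γ Δ P, R (P ::ₘ Γ) Δ → R Γ (P ::ₘ Δ) → R Γ Δ)
    (lit : ℕ → Fin 2 → A) (em : ∀ X, R 0 {lit X 0, lit X 1}) (Γ Δ : Multiset A) :
    ∀ N, (∀ v, R (literals lit v N + Γ) Δ) → R Γ Δ
  | 0, h => by simpa [literals] using h 0
  | N + 1, h => by
    refine eliminate_literals weakL weakR cut lit em Γ Δ N fun v => ?_
    have key : ∀ b, R (lit N b ::ₘ (literals lit v N + Γ)) Δ := fun b => by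
      have hb := h (Function.update v N b)
      rw [literals, Function.update_self, Multiset.cons_add,
        literals_congr lit (w := v) fun X hX => Function.update_of_ne hX.ne _ _] at hb
      exact hb
    refine cut _ _ _ (key 0) (cut _ _ (lit N 1) (weakR _ _ _ (key 1)) ?_)
    refine weaken_of_le weakL weakR (em N) (Multiset.zero_le _) ?_
    rw [Multiset.insert_eq_cons, Multiset.cons_swap]
    exact Multiset.cons_le_cons _ (Multiset.cons_le_cons _ (Multiset.zero_le _))

/-- `P` is decided by the literals of every valuation on sufficiently many variables. -/
def Decided (R : Multiset A → Multiset A → Prop) (lit : ℕ → Fin 2 → A)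
    (sem : (ℕ → Fin 2) → A → Fin 2) (P : A) : Prop :=
  ∀ᶠ N in Filter.atTop, ∀ v, (sem v P = 0 → R (literals lit v N) {P}) ∧
    (sem v P = 1 → R (P ::ₘ literals lit v N) 0)

theorem complete_of_decided (weakL : ∀ Γ Δ P, R Γ Δ → R (P ::ₘ Γ) Δ)
    (weakR : ∀ Γ Δ P, R Γ Δ → R Γ (P ::ₘ Δ))
    (cut : ∀ Γ Δ P, R (P ::ₘ Γ) Δ → R Γ (P ::ₘ Δ) → R Γ Δ)
    {lit : ℕ → Fin 2 → A} (em : ∀ X, R 0 {lit X 0, lit X 1})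
    {sem : (ℕ → Fin 2) → A → Fin 2} (dec : ∀ P, Decided R lit sem P) {Γ Δ : Multiset A}
    (h : ∀ v, (∀ P ∈ Γ, sem v P = 0) → ∃ Q ∈ Δ, sem v Q = 0) : R Γ Δ := by
  classical
  have hall : ∀ᶠ N in Filter.atTop, ∀ P ∈ (Γ + Δ).toFinset, ∀ v,
      (sem v P = 0 → R (literals lit v N) {P}) ∧
        (sem v P = 1 → R (P ::ₘ literals lit v N) 0) :=
    (Filter.eventually_all_finset _).mpr fun P _ => dec P
  obtain ⟨N, hN⟩ := hall.exists
  refine eliminate_literals weakL weakR cut lit em Γ Δ N fun v => ?_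
  by_cases hv : ∀ P ∈ Γ, sem v P = 0
  · obtain ⟨Q, hQ, hvQ⟩ := h v hv
    exact weaken_of_le weakL weakR ((hN Q (by simp [hQ]) v).1 hvQ)
      (Multiset.le_add_right _ _) (Multiset.singleton_le.mpr hQ)
  · push Not at hv
    obtain ⟨P, hP, hvP⟩ := hv
    refine weaken_of_le weakL weakR ((hN P (by simp [hP]) v).2 (by omega)) ?_
      (Multiset.zero_le _)
    rw [← Multiset.singleton_add, add_comm]
    exact Multiset.add_le_add_left (Multiset.singleton_le.mpr hP)

end Kalmar

section Classical

theorem PProves.weaken {Γ Γ' Δ Δ' : Multiset PFm} (h : PProves Γ Δ) (hΓ : Γ ≤ Γ')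
    (hΔ : Δ ≤ Δ') : PProves Γ' Δ' :=
  weaken_of_le PProves.weakL PProves.weakR h hΓ hΔ

theorem PProves.sound {Γ Δ : Multiset PFm} (h : PProves Γ Δ) : PModels Γ Δ := by
  intro v
  induction h <;>
    simp only [Multiset.mem_cons, Multiset.mem_singleton, forall_eq_or_imp,
      exists_eq_or_imp, PFm.sem, forall_eq, exists_eq_left, Multiset.notMem_zero] at * <;>
    grind

/-- The literal of the variable `X` that holds when `X` has value `b`. -/
def PFm.lit (X : ℕ) (b : Fin 2) : PFm := if b = 0 then .var X else .neg (.var X)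

theorem PFm.decided (P : PFm) : Decided PProves PFm.lit PFm.sem P := by
  induction P with
  | tru =>
    refine Filter.Eventually.of_forall fun N v => ⟨fun _ => ?_, fun h => absurd h (by simp [sem])⟩
    exact PProves.tru.weaken (Multiset.zero_le _) le_rfl
  | fls =>
    refine Filter.Eventually.of_forall fun N v => ⟨fun h => absurd h (by simp [sem]), fun _ => ?_⟩
    exact PProves.fls.weaken (by simp) le_rfl
  | var X =>
    filter_upwards [Filter.eventually_gt_atTop X] with N hN v
    have hmem := mem_literals PFm.lit v hN
    refine ⟨fun h => ?_, fun h => ?_⟩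
    · rw [sem] at h
      rw [h, PFm.lit, if_pos rfl] at hmem
      exact (PProves.id _).weaken (Multiset.singleton_le.mpr hmem) le_rfl
    · rw [sem] at h
      rw [h, PFm.lit, if_neg (by decide)] at hmem
      refine (PProves.negL _ _ _ (PProves.id (.var X))).weaken ?_ le_rfl
      refine (Multiset.pair_comm _ _).trans_le ?_
      exact Multiset.cons_le_cons _ (Multiset.singleton_le.mpr hmem)
  | neg P ih =>
    filter_upwards [ih] with N hN v
    refine ⟨fun h => PProves.negR _ _ _ ((hN v).2 ?_), fun h => PProves.negL _ _ _ ((hN v).1 ?_)⟩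
    all_goals
      simp only [sem] at h
      grind
  | and P Q ihP ihQ =>
    filter_upwards [ihP, ihQ] with N hP hQ v
    refine ⟨fun h => ?_, fun h => PProves.andL _ _ _ _ ?_⟩
    · simp only [sem, ite_eq_left_iff, one_ne_zero, imp_false, not_not] at h
      exact PProves.andR _ _ _ _ ((hP v).1 h.1) ((hQ v).1 h.2)
    · have h' : sem v P = 1 ∨ sem v Q = 1 := by
        simp only [sem] at h
        grind
      rcases h' with h' | h'
      · rw [Multiset.cons_swap]
        exact PProves.weakL _ _ _ ((hP v).2 h')
      · exact PProves.weakL _ _ _ ((hQ v).2 h')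
  | or P Q ihP ihQ =>
    filter_upwards [ihP, ihQ] with N hP hQ v
    refine ⟨fun h => PProves.orR _ _ _ _ ?_, fun h => ?_⟩
    · simp only [sem, ite_eq_left_iff, one_ne_zero, imp_false, not_not] at h
      rcases h with h | h
      · rw [Multiset.cons_swap]
        exact PProves.weakR _ _ _ ((hP v).1 h)
      · exact PProves.weakR _ _ _ ((hQ v).1 h)
    · have h' : sem v P = 1 ∧ sem v Q = 1 := by
        simp only [sem] at h
        grind
      exact PProves.orL _ _ _ _ ((hP v).2 h'.1) ((hQ v).2 h'.2)

theorem PProves.complete {Γ Δ : Multiset PFm} (h : PModels Γ Δ) : PProves Γ Δ := by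
  refine complete_of_decided PProves.weakL PProves.weakR PProves.cut (lit := PFm.lit)
    (fun X => ?_) PFm.decided h
  rw [PFm.lit, PFm.lit, if_pos rfl, if_neg (by decide), Multiset.pair_comm]
  exact PProves.negR _ _ _ (PProves.id _)

theorem pproves_iff_pmodels {Γ Δ : Multiset PFm} : PProves Γ Δ ↔ PModels Γ Δ :=
  ⟨PProves.sound, PProves.complete⟩

end Classical

section Action

variable {n : ℕ}

theorem Fm.act_act (ρ σ : Equiv.Perm (Fin n)) (F : Fm n) :
    (F.act σ).act ρ = F.act (ρ * σ) := by
  induction F with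
  | var X π => simp [Fm.act, mul_assoc]
  | const k => simp [Fm.act]
  | q F G _ ih => simp [Fm.act, ih]

@[simp] theorem Fm.act_one (F : Fm n) : F.act 1 = F := by
  induction F with
  | var X π => simp [Fm.act]
  | const k => simp [Fm.act]
  | q F G _ ih => simp [Fm.act, ih]

@[simp] theorem Fm.act_refl (F : Fm n) : F.act (Equiv.refl _) = F :=
  F.act_one

@[simp] theorem actM_refl (Γ : Multiset (Fm n)) : actM (Equiv.refl _) Γ = Γ := by
  simp [actM]

@[simp] theorem actM_cons (ρ : Equiv.Perm (Fin n)) (F : Fm n) (Γ : Multiset (Fm n)) :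
    actM ρ (F ::ₘ Γ) = F.act ρ ::ₘ actM ρ Γ :=
  Multiset.map_cons _ _ _

@[simp] theorem Fm.act_swap_swap (i j : Fin n) (F : Fm n) :
    (F.act (Equiv.swap i j)).act (Equiv.swap i j) = F := by
  simp [Fm.act_act]

@[simp] theorem actM_swap_swap (i j : Fin n) (Γ : Multiset (Fm n)) :
    actM (Equiv.swap i j) (actM (Equiv.swap i j) Γ) = Γ := by
  simp [actM]

@[simp] theorem Fm.sem_act (v : ℕ → Fin n) (ρ : Equiv.Perm (Fin n)) (F : Fm n) :
    (F.act ρ).sem v = ρ (F.sem v) := by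
  induction F with
  | var X π => simp [Fm.act, Fm.sem]
  | const k => simp [Fm.act, Fm.sem]
  | q F G _ ih => simp [Fm.act, Fm.sem, ih]

end Action

section Soundness

variable {n : ℕ}

theorem forall_sem_actM_swap {v : ℕ → Fin n} {Γ : Multiset (Fm n)} {i j : Fin n} :
    (∀ G ∈ actM (Equiv.swap i j) Γ, G.sem v = i) ↔ ∀ G ∈ Γ, G.sem v = j := by
  simp [actM, Equiv.swap_apply_eq_iff]

theorem exists_sem_actM_swap {v : ℕ → Fin n} {Δ : Multiset (Fm n)} {i j : Fin n} :
    (∃ G ∈ actM (Equiv.swap i j) Δ, G.sem v = i) ↔ ∃ G ∈ Δ, G.sem v = j := by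
  simp [actM, Equiv.swap_apply_eq_iff]

theorem Proves.sound {Γ Δ : Multiset (Fm n)} {i : Fin n} (h : Proves Γ i Δ) : Models Γ i Δ := by
  intro v
  induction h <;>
    simp only [Multiset.mem_cons, Multiset.mem_singleton, forall_eq_or_imp,
      exists_eq_or_imp, forall_sem_actM_swap, exists_sem_actM_swap, Fm.sem_act,
      Fm.sem, forall_eq, exists_eq_left, Multiset.notMem_zero,
      Equiv.swap_apply_eq_iff, Equiv.swap_apply_left] at *
  case id X π ρ i h =>
    intro hX
    rw [← hX, Equiv.Perm.eq_inv_iff_eq, Equiv.Perm.inv_def, Equiv.symm_apply_apply] at h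
    rw [h, hX]
  case neg2 Γ Δ F i j k hjk _ ih =>
    rintro ⟨hF, hΓ⟩
    refine (ih hΓ).resolve_left fun hi => ?_
    rw [hi, Equiv.swap_apply_def] at hF
    grind
  case neg3 Γ Δ F j _ ih =>
    intro hΓ
    exact or_iff_not_imp_left.mpr fun hF => ih _ hF ⟨rfl, hΓ⟩
  all_goals grind

end Soundness

section TwoDimensional

variable {Γ Δ : Multiset (Fm 2)} {F : Fm 2} {G : Fin 2 → Fm 2}

theorem Proves.weaken {Γ' Δ' : Multiset (Fm 2)} (h : Proves Γ 0 Δ) (hΓ : Γ ≤ Γ')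
    (hΔ : Δ ≤ Δ') : Proves Γ' 0 Δ' :=
  weaken_of_le (R := fun Γ Δ => Proves Γ 0 Δ) (fun _ _ _ => .weakL _ _ _ _)
    (fun _ _ _ => .weakR _ _ _ _) h hΓ hΔ

theorem Proves.negL (h : Proves Γ 0 (F ::ₘ Δ)) :
    Proves (F.act (Equiv.swap 0 1) ::ₘ Γ) 0 Δ :=
  .neg1 Γ Δ F 0 0 1 (by decide) (by simpa using h)

theorem Proves.negR (h : Proves (F ::ₘ Γ) 0 Δ) :
    Proves Γ 0 (F.act (Equiv.swap 0 1) ::ₘ Δ) := by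
  refine .neg3 Γ Δ _ 0 fun i hi => ?_
  obtain rfl : i = 1 := by omega
  refine .sym _ _ 0 1 ?_
  simpa [Equiv.swap_comm (1 : Fin 2) 0] using h

theorem Proves.qL_zero (h₀ : Proves (G 0 ::ₘ F ::ₘ Γ) 0 Δ)
    (h₁ : Proves (G 1 ::ₘ F.act (Equiv.swap 0 1) ::ₘ Γ) 0 Δ) :
    Proves (Fm.q F G ::ₘ Γ) 0 Δ := by
  refine .qL Γ Δ F G 0 (Fin.forall_fin_two.mpr ⟨by simpa using h₀, .sym _ _ 0 1 ?_⟩)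
  simpa [Equiv.swap_comm (1 : Fin 2) 0] using h₁

theorem Proves.qR_zero (h₀ : Proves (F ::ₘ Γ) 0 (G 0 ::ₘ Δ))
    (h₁ : Proves (F.act (Equiv.swap 0 1) ::ₘ Γ) 0 (G 1 ::ₘ Δ)) :
    Proves Γ 0 (Fm.q F G ::ₘ Δ) := by
  refine .qR Γ Δ F G 0 (Fin.forall_fin_two.mpr ⟨by simpa using h₀, .sym _ _ 0 1 ?_⟩)
  simpa [Equiv.swap_comm (1 : Fin 2) 0] using h₁

/-- The decorated variable on `X` that has value `0` when `X` has value `b`. -/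
def Fm.lit (X : ℕ) (b : Fin 2) : Fm 2 := .var X (Equiv.swap 0 b)

theorem Fm.decided (F : Fm 2) :
    Decided (fun Γ Δ => Proves Γ 0 Δ) Fm.lit Fm.sem F := by
  induction F with
  | var X π =>
    filter_upwards [Filter.eventually_gt_atTop X] with N hN v
    have hmem := mem_literals Fm.lit v hN
    have key : ∀ ρ : Equiv.Perm (Fin 2), ρ (v X) = 0 →
        Proves {Fm.lit X (v X)} 0 {Fm.var X ρ} := fun ρ hρ =>
      .id _ _ _ _ (by rw [Equiv.Perm.eq_inv_iff_eq, Equiv.swap_inv, Equiv.swap_apply_left, hρ])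
    refine ⟨fun h => (key π h).weaken (Multiset.singleton_le.mpr hmem) le_rfl, fun h => ?_⟩
    rw [sem] at h
    have h' := (key (Equiv.swap 0 1 * π) (by simp [h])).negL
    rw [Fm.act, Equiv.swap_mul_self_mul] at h'
    exact h'.weaken (Multiset.cons_le_cons _ (Multiset.singleton_le.mpr hmem)) le_rfl
  | const k =>
    refine Filter.Eventually.of_forall fun N v => ⟨fun h => ?_, fun h => ?_⟩
    · rw [sem] at h
      subst h
      exact (Proves.const 0).weaken (Multiset.zero_le _) le_rfl
    · rw [sem] at h
      have h' := (Proves.const (0 : Fin 2)).negL (Δ := 0)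
      rw [Fm.act, Equiv.swap_apply_left] at h'
      subst h
      exact h'.weaken (Multiset.cons_le_cons _ (Multiset.zero_le _)) le_rfl
  | q F G ihF ihG =>
    filter_upwards [ihF, ihG 0, ihG 1] with N hF h₀ h₁ v
    rcases Fin.exists_fin_two.mp ⟨F.sem v, rfl⟩ with hv | hv
    · have hF' := ((hF v).1 hv).negL (Δ := 0)
      simp only [sem, hv]
      exact ⟨fun h => .qR_zero (.weakL _ _ _ _ ((h₀ v).1 h)) (.weakR _ _ _ _ hF'),
        fun h => .qL_zero (by rw [Multiset.cons_swap]; exact .weakL _ _ _ _ ((h₀ v).2 h))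
          (.weakL _ _ _ _ hF')⟩
    · have hF' := (hF v).2 hv
      simp only [sem, hv]
      exact ⟨fun h => .qR_zero (.weakR _ _ _ _ hF') (.weakL _ _ _ _ ((h₁ v).1 h)),
        fun h => .qL_zero (.weakL _ _ _ _ hF')
          (by rw [Multiset.cons_swap]; exact .weakL _ _ _ _ ((h₁ v).2 h))⟩

theorem Proves.complete (h : Models Γ 0 Δ) : Proves Γ 0 Δ := by
  refine complete_of_decided (R := fun Γ Δ => Proves Γ 0 Δ) (fun _ _ _ => .weakL _ _ _ _)
    (fun _ _ _ => .weakR _ _ _ _) (fun _ _ _ => .cut _ _ _ _) (lit := Fm.lit)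
    (fun X => ?_) Fm.decided h
  have h' := (Proves.id X 1 1 (0 : Fin 2) rfl).negR (Γ := 0)
  rw [Fm.act, mul_one] at h'
  rw [Multiset.pair_comm, Fm.lit, Fm.lit, Equiv.swap_self]
  exact h'

theorem proves_zero_iff_models : Proves Γ 0 Δ ↔ Models Γ 0 Δ :=
  ⟨Proves.sound, Proves.complete⟩

end TwoDimensional

theorem sem_toPC (v : ℕ → Fin 2) (F : Fm 2) : (toPC F).sem v = F.sem v := by
  induction F with
  | var X π =>
    have hπ : π 0 ≠ π 1 := π.injective.ne (by decide)
    rcases Fin.exists_fin_two.mp ⟨v X, rfl⟩ with hv | hv <;>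
      simp only [toPC, Fm.sem, hv] <;> split_ifs <;> simp only [PFm.sem, hv] <;> grind
  | const k => simp only [toPC, Fm.sem]; split_ifs <;> simp only [PFm.sem] <;> grind
  | q F G ihF ihG =>
    rcases Fin.exists_fin_two.mp ⟨F.sem v, rfl⟩ with hv | hv <;>
      simp only [toPC, Fm.sem, PFm.sem, ihF, ihG, hv] <;> grind

theorem sem_toFm (v : ℕ → Fin 2) (P : PFm) : (toFm P).sem v = P.sem v := by
  induction P with
  | tru => rfl
  | fls => rfl
  | var X => rfl
  | neg P ih =>
    rcases Fin.exists_fin_two.mp ⟨P.sem v, rfl⟩ with hv | hv <;>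
      simp [toFm, PFm.sem, ih, hv]
  | and P Q ihP ihQ =>
    rcases Fin.exists_fin_two.mp ⟨P.sem v, rfl⟩ with hv | hv <;>
      grind [toFm, PFm.sem, Fm.sem, Matrix.cons_val_zero, Matrix.cons_val_one]
  | or P Q ihP ihQ =>
    rcases Fin.exists_fin_two.mp ⟨P.sem v, rfl⟩ with hv | hv <;>
      grind [toFm, PFm.sem, Fm.sem, Matrix.cons_val_zero, Matrix.cons_val_one]

/-- `Γ ⊢_1 Δ` is provable in 2PC iff `Γ• ⊢ Δ•` is provable in PC, and
`Γ₁ ⊢ Δ₁` is provable in PC iff `Γ₁° ⊢_1 Δ₁°` is provable in 2PC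
(dimension `1` of the paper is encoded as `0 : Fin 2`). -/
theorem translations_preserve_provability (Γ Δ : Multiset (Fm 2))
    (Γ1 Δ1 : Multiset PFm) :
    (Proves Γ 0 Δ ↔ PProves (Γ.map toPC) (Δ.map toPC)) ∧
    (PProves Γ1 Δ1 ↔ Proves (Γ1.map toFm) 0 (Δ1.map toFm)) := by
  simp [proves_zero_iff_models, pproves_iff_pmodels, Models, PModels, sem_toPC, sem_toFm]
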